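/- At the critical ratio λ = 1/2 the separability probability is exactly one half for every dimension: for every d ≥ 1, if x_1, …, x_{2d} are independent samples from the standard Gaussian measure N(0, I_d) on ℝ^d, then the probability that {x_1, …, x_{2d}} is linearly separable from the origin equals 1/2. Equivalently, 2^{−(2d−1)} · Σ_{k=0}^{d−1} C(2d−1, k) = 1/2. -/

import Mathlib

open MeasureTheory ProbabilityTheory Real

/-- A finite family of points in `ℝ^d` is linearly separable from the origin iff some
vector `S` has strictly positive inner product with all of them. -/
def SeparableFromOrigin {d N : ℕ} (x : Fin N → Fin d → ℝ) : Prop :=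
  ∃ S : Fin d → ℝ, ∀ i, 0 < ∑ j, S j * x i j

namespace Wendel

/-- The real sign attached to a Boolean. -/
def sg (b : Bool) : ℝ := if b then 1 else -1

/-- The sign pattern `ε` is realised by the functionals `f` at a point of `W`. -/
def Feas {E : Type} [AddCommGroup E] [Module ℝ E] {n : ℕ} (W : Submodule ℝ E)
    (f : Fin n → E →ₗ[ℝ] ℝ) (ε : Fin n → Bool) : Prop :=
  ∃ S ∈ W, ∀ i, 0 < sg (ε i) * f i S

open Classical in
/-- The number of realised sign patterns. -/
noncomputable def cnt {E : Type} [AddCommGroup E] [Module ℝ E] {n : ℕ} (W : Submodule ℝ E)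
    (f : Fin n → E →ₗ[ℝ] ℝ) : ℕ :=
  ∑ ε : Fin n → Bool, if Feas W f ε then 1 else 0

/-- The Wendel / Cover numbers. -/
def g : ℕ → ℕ → ℕ
  | 0, _ => 1
  | _ + 1, 0 => 0
  | n + 1, k + 1 => g n (k + 1) + g n k

lemma g_eq (n k : ℕ) : g (n + 1) k = 2 * ∑ j ∈ Finset.range k, n.choose j := by
  induction n generalizing k with
  | zero =>
    cases k with
    | zero => simp [g]
    | succ k => simp [g, Finset.sum_range_succ']
  | succ n ih =>
    cases k with
    | zero => simp [g]
    | succ k =>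
      rw [g, ih, ih, Finset.sum_range_succ' (fun j => (n + 1).choose j)]
      simp only [Nat.choose_succ_succ, Finset.sum_add_distrib]
      rw [Finset.sum_range_succ' (fun j => n.choose j)]
      simp
      ring

variable {E : Type} [AddCommGroup E] [Module ℝ E]

lemma feas_cons {n : ℕ} (W : Submodule ℝ E) (f : Fin (n + 1) → E →ₗ[ℝ] ℝ) (b : Bool)
    (ε : Fin n → Bool) :
    Feas W f (Fin.cons b ε : Fin (n + 1) → Bool) ↔
      ∃ S ∈ W, 0 < sg b * f 0 S ∧ ∀ i : Fin n, 0 < sg (ε i) * f i.succ S := by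
  simp [Feas, Fin.forall_fin_succ]

lemma both_of_restrict {n : ℕ} (W : Submodule ℝ E) (f : Fin (n + 1) → E →ₗ[ℝ] ℝ)
    (v : E) (hv : v ∈ W) (hfv : f 0 v ≠ 0) (ε : Fin n → Bool) (b : Bool)
    (h : Feas (W ⊓ LinearMap.ker (f 0)) (fun i => f i.succ) ε) :
    Feas W f (Fin.cons b ε : Fin (n + 1) → Bool) := by
  obtain ⟨S, hS, hpos⟩ := h
  rw [feas_cons]
  have hb : sg b * sg b = 1 := by cases b <;> simp [sg]
  have hev : ∀ i : Fin n, ∀ᶠ t : ℝ in nhds 0,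
      0 < sg (ε i) * f i.succ (S + (t * (sg b * f 0 v)) • v) := by
    intro i
    have hc : Continuous fun t : ℝ => sg (ε i) * f i.succ (S + (t * (sg b * f 0 v)) • v) := by
      simp only [map_add, map_smul, smul_eq_mul]
      fun_prop
    refine hc.continuousAt.eventually (lt_mem_nhds ?_)
    simpa using hpos i
  have h2 := (Filter.eventually_all.2 hev)
  have h3 : ∀ᶠ t : ℝ in nhdsWithin 0 (Set.Ioi 0), _ := h2.filter_mono nhdsWithin_le_nhds
  obtain ⟨t, ht, ht0⟩ := (h3.and self_mem_nhdsWithin).exists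
  refine ⟨S + (t * (sg b * f 0 v)) • v, W.add_mem hS.1 (W.smul_mem _ hv), ?_, ht⟩
  have h0 : f 0 S = 0 := hS.2
  simp only [map_add, map_smul, smul_eq_mul, h0]
  have : sg b * (0 + t * (sg b * f 0 v) * f 0 v) = t * (f 0 v) ^ 2 := by
    linear_combination (t * (f 0 v) ^ 2) * hb
  rw [this]
  have ht0 : (0:ℝ) < t := ht0
  positivity

lemma restrict_of_both {n : ℕ} (W : Submodule ℝ E) (f : Fin (n + 1) → E →ₗ[ℝ] ℝ)
    (ε : Fin n → Bool)
    (h1 : Feas W f (Fin.cons true ε : Fin (n + 1) → Bool))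
    (h2 : Feas W f (Fin.cons false ε : Fin (n + 1) → Bool)) :
    Feas (W ⊓ LinearMap.ker (f 0)) (fun i => f i.succ) ε := by
  rw [feas_cons] at h1 h2
  obtain ⟨S, hS, hS0, hSp⟩ := h1
  obtain ⟨T, hT, hT0, hTp⟩ := h2
  simp only [sg, if_true, one_mul, Bool.false_eq_true, if_false, neg_mul] at hS0 hT0
  refine ⟨f 0 S • T + (-f 0 T) • S,
    ⟨W.add_mem (W.smul_mem _ hT) (W.smul_mem _ hS), ?_⟩, fun i => ?_⟩
  · simp only [SetLike.mem_coe, LinearMap.mem_ker, map_add, map_smul, smul_eq_mul]; ring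
  · simp only [map_add, map_smul, smul_eq_mul]
    have a := mul_pos hS0 (hTp i)
    have b := mul_pos hT0 (hSp i)
    nlinarith

lemma feas_iff_or {n : ℕ} (W : Submodule ℝ E) (f : Fin (n + 1) → E →ₗ[ℝ] ℝ)
    (v : E) (hv : v ∈ W) (hfv : f 0 v ≠ 0) (ε : Fin n → Bool) :
    Feas W (fun i => f i.succ) ε ↔
      Feas W f (Fin.cons true ε : Fin (n + 1) → Bool) ∨
      Feas W f (Fin.cons false ε : Fin (n + 1) → Bool) := by
  constructor
  · rintro ⟨S, hS, hp⟩
    rcases lt_trichotomy (f 0 S) 0 with h | h | h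
    · right
      rw [feas_cons]
      exact ⟨S, hS, by simpa [sg] using h, hp⟩
    · left
      exact both_of_restrict W f v hv hfv ε true ⟨S, ⟨hS, h⟩, hp⟩
    · left
      rw [feas_cons]
      exact ⟨S, hS, by simpa [sg] using h, hp⟩
  · rintro (h | h) <;> rw [feas_cons] at h <;> obtain ⟨S, hS, -, hp⟩ := h <;> exact ⟨S, hS, hp⟩

lemma cnt_succ {n : ℕ} (W : Submodule ℝ E) (f : Fin (n + 1) → E →ₗ[ℝ] ℝ)
    (v : E) (hv : v ∈ W) (hfv : f 0 v ≠ 0) :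
    cnt W f = cnt W (fun i => f i.succ) +
      cnt (W ⊓ LinearMap.ker (f 0)) (fun i => f i.succ) := by
  classical
  unfold cnt
  rw [← (Fin.consEquiv (fun _ : Fin (n + 1) => Bool)).sum_comp, Fintype.sum_prod_type,
    Fintype.sum_bool, ← Finset.sum_add_distrib, ← Finset.sum_add_distrib]
  refine Finset.sum_congr rfl fun ε _ => ?_
  have h1 := feas_iff_or W f v hv hfv ε
  have h2 : Feas (W ⊓ LinearMap.ker (f 0)) (fun i => f i.succ) ε ↔
      Feas W f (Fin.cons true ε : Fin (n + 1) → Bool) ∧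
      Feas W f (Fin.cons false ε : Fin (n + 1) → Bool) :=
    ⟨fun h => ⟨both_of_restrict W f v hv hfv ε _ h, both_of_restrict W f v hv hfv ε _ h⟩,
      fun h => restrict_of_both W f ε h.1 h.2⟩
  simp only [Fin.consEquiv, Equiv.coe_fn_mk, h1, h2]
  by_cases a : Feas W f (Fin.cons true ε : Fin (n + 1) → Bool) <;>
  by_cases b : Feas W f (Fin.cons false ε : Fin (n + 1) → Bool) <;> simp [a, b]

lemma cnt_eq [FiniteDimensional ℝ E] (n : ℕ) (W : Submodule ℝ E) (f : Fin n → E →ₗ[ℝ] ℝ)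
    (hgp : ∀ s : Finset (Fin n),
      Module.finrank ℝ (W ⊓ ⨅ i ∈ s, LinearMap.ker (f i) : Submodule ℝ E)
        = Module.finrank ℝ W - s.card) :
    cnt W f = g n (Module.finrank ℝ W) := by
  classical
  induction n generalizing W with
  | zero =>
    have : ∀ ε, Feas W f ε := fun ε => ⟨0, W.zero_mem, fun i => i.elim0⟩
    simp [cnt, this, g]
  | succ n ih =>
    have h0 := hgp {0}
    rw [Finset.iInf_singleton, Finset.card_singleton] at h0
    rcases hk : Module.finrank ℝ W with _ | k
    · have hW : W = ⊥ := Submodule.finrank_eq_zero.1 hk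
      have : ∀ ε, ¬ Feas W f ε := by
        rintro ε ⟨S, hS, hp⟩
        have hS0 : S = 0 := by simpa [hW] using hS
        simpa [hS0] using hp 0
      simp [cnt, this, g]
    · obtain ⟨v, hv, hfv⟩ : ∃ v ∈ W, f 0 v ≠ 0 := by
        by_contra! hcon
        have : W ⊓ LinearMap.ker (f 0) = W := inf_eq_left.2 fun v hv => hcon v hv
        rw [this] at h0
        omega
      have key : ∀ s : Finset (Fin n), (⨅ i ∈ s.map (Fin.succEmb n), LinearMap.ker (f i))
          = ⨅ i ∈ s, LinearMap.ker (f i.succ) := by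
        intro s
        simp only [Finset.mem_map, iInf_exists, iInf_and]
        rw [iInf_comm]
        refine iInf_congr fun i => ?_
        rw [iInf_comm]
        simp
      rw [cnt_succ W f v hv hfv, ih, ih, h0, hk]
      · rfl
      · intro s
        have := hgp (insert 0 (s.map (Fin.succEmb n)))
        rw [Finset.iInf_insert, key, ← inf_assoc, Finset.card_insert_of_notMem, Finset.card_map]
          at this
        · rw [this]; omega
        · simp
      · intro s
        have := hgp (s.map (Fin.succEmb n))
        rwa [key, Finset.card_map] at this

end Wendel

namespace Wendel

/-- Standard Gaussian on `ℝ^d`. -/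
noncomputable abbrev nu (d : ℕ) : Measure (Fin d → ℝ) := Measure.pi fun _ : Fin d => gaussianReal 0 1

lemma ae_dot_ne {d : ℕ} (v : Fin d → ℝ) (hv : v ≠ 0) :
    ∀ᵐ y ∂nu d, ∑ j, v j * y j ≠ 0 := by
  obtain ⟨i, hi⟩ := Function.ne_iff.1 hv
  cases d with
  | zero => exact i.elim0
  | succ m =>
    have hmp := measurePreserving_piFinSuccAbove (fun _ : Fin (m + 1) => gaussianReal 0 1) i
    have hms : MeasurableSet {p : ℝ × (Fin m → ℝ) |
        v i * p.1 + ∑ j, v (i.succAbove j) * p.2 j ≠ 0} := by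
      refine (IsOpen.measurableSet ?_)
      exact isOpen_ne_fun (by fun_prop) (by fun_prop)
    have : ∀ᵐ p ∂((gaussianReal 0 1).prod (Measure.pi fun _ : Fin m => gaussianReal 0 1)),
        v i * p.1 + ∑ j, v (i.succAbove j) * p.2 j ≠ 0 := by
      rw [Measure.ae_prod_iff_ae_ae hms, Measure.ae_ae_comm hms]
      refine Filter.Eventually.of_forall fun z => ?_
      have : NullSingletonClass (gaussianReal 0 1) := nullSingletonClass_gaussianReal (by norm_num)
      filter_upwards [Measure.ae_ne (gaussianReal 0 1)
        (-(∑ j, v (i.succAbove j) * z j) / v i)] with a ha h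
      apply ha
      have hi' : v i ≠ 0 := hi
      field_simp
      linarith
    have h2 := hmp.quasiMeasurePreserving.ae this
    filter_upwards [h2] with y hy
    rw [Fin.sum_univ_succAbove _ i]
    simpa [Fin.removeNth] using hy

lemma ae_notMem {d : ℕ} (U : Submodule ℝ (Fin d → ℝ)) (hU : U ≠ ⊤) :
    ∀ᵐ y ∂nu d, y ∉ U := by
  obtain ⟨f, hf0, hf⟩ := U.exists_le_ker_of_lt_top (lt_top_iff_ne_top.2 hU)
  have hrep : ∀ y, f y = ∑ j, f (Pi.single j 1) * y j := by
    intro y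
    rw [LinearMap.pi_apply_eq_sum_univ f y]
    refine Finset.sum_congr rfl fun j _ => ?_
    rw [smul_eq_mul, mul_comm]
    congr 2
    ext k
    simp [Pi.single_apply, eq_comm]
  have hv : (fun j => f (Pi.single j 1)) ≠ 0 := by
    intro h
    apply hf0
    ext y
    simpa using congrFun h y
  filter_upwards [ae_dot_ne _ hv] with y hy hyU
  exact hy (by rw [← hrep]; exact hf hyU)

lemma ae_linearIndependent (d n : ℕ) (hn : n ≤ d) :
    ∀ᵐ x ∂(Measure.pi fun _ : Fin n => nu d), LinearIndependent ℝ x := by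
  induction n with
  | zero => exact Filter.Eventually.of_forall fun x => linearIndependent_empty_type
  | succ n ih =>
    have hmp := measurePreserving_piFinSuccAbove (fun _ : Fin (n + 1) => nu d) 0
    have hms : MeasurableSet {p : (Fin d → ℝ) × (Fin n → Fin d → ℝ) |
        LinearIndependent ℝ (Fin.cons p.1 p.2 : Fin (n + 1) → Fin d → ℝ)} := by
      refine IsOpen.measurableSet ?_
      refine isOpen_setOfPred_linearIndependent.preimage (f := fun p : (Fin d → ℝ) × (Fin n → Fin d → ℝ) =>
        (Fin.cons p.1 p.2 : Fin (n + 1) → Fin d → ℝ)) ?_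
      refine continuous_pi fun i => ?_
      refine Fin.cases ?_ (fun i => ?_) i
      · simpa using continuous_fst
      · simp only [Fin.cons_succ]; fun_prop
    have : ∀ᵐ p ∂((nu d).prod (Measure.pi fun _ : Fin n => nu d)),
        LinearIndependent ℝ (Fin.cons p.1 p.2 : Fin (n + 1) → Fin d → ℝ) := by
      rw [Measure.ae_prod_iff_ae_ae hms, Measure.ae_ae_comm hms]
      filter_upwards [ih (by omega)] with x hx
      have hU : Submodule.span ℝ (Set.range x) ≠ ⊤ := by
        intro h
        have h1 := finrank_span_eq_card hx
        rw [h] at h1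
        simp at h1
        omega
      filter_upwards [ae_notMem _ hU] with y hy
      exact linearIndependent_finCons.2 ⟨hx, hy⟩
    have h2 := hmp.quasiMeasurePreserving.ae this
    filter_upwards [h2] with y hy
    convert hy using 1
    ext i
    refine Fin.cases ?_ (fun i => ?_) i <;> simp [MeasurableEquiv.piFinSuccAbove, Fin.insertNthEquiv, Fin.tail]

lemma measurePreserving_reindex {α : Type} [MeasurableSpace α] (μ : Measure α)
    [IsProbabilityMeasure μ] {n N : ℕ} (e : Fin n → Fin N) (he : Function.Injective e) :
    MeasurePreserving (fun x : Fin N → α => fun k => x (e k)) (Measure.pi fun _ : Fin N => μ)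
      (Measure.pi fun _ : Fin n => μ) := by
  refine ⟨by fun_prop, ?_⟩
  have h := iIndepFun_pi (μ := fun _ : Fin N => μ) (X := fun _ => (id : α → α))
    (fun i => aemeasurable_id)
  have h2 := h.precomp he
  simp only [id] at h2
  have hm : ∀ i : Fin n, AEMeasurable (fun ω : Fin N → α => ω (e i))
      (Measure.pi fun _ : Fin N => μ) := fun i => (measurable_pi_apply (e i)).aemeasurable
  rw [iIndepFun_iff_map_fun_eq_pi_map hm] at h2
  rw [h2]
  congr 1
  ext1 i
  exact (measurePreserving_eval (fun _ : Fin N => μ) (e i)).map_eq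

/-- the functional of a point -/
noncomputable def fn {d N : ℕ} (x : Fin N → Fin d → ℝ) (i : Fin N) : (Fin d → ℝ) →ₗ[ℝ] ℝ :=
  ∑ j, x i j • LinearMap.proj j

lemma fn_apply {d N : ℕ} (x : Fin N → Fin d → ℝ) (i : Fin N) (S : Fin d → ℝ) :
    fn x i S = ∑ j, S j * x i j := by
  simp [fn, mul_comm]

lemma finrank_of_li {d N : ℕ} (x : Fin N → Fin d → ℝ) (s : Finset (Fin N))
    (h : LinearIndependent ℝ (fun k => x (s.orderEmbOfFin rfl k))) :
    Module.finrank ℝ (⨅ i ∈ s, LinearMap.ker (fn x i) : Submodule ℝ (Fin d → ℝ)) = d - s.card := by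
  set A : Matrix (Fin s.card) (Fin d) ℝ := Matrix.of fun k => x (s.orderEmbOfFin rfl k) with hA
  have hker : (⨅ i ∈ s, LinearMap.ker (fn x i) : Submodule ℝ (Fin d → ℝ))
      = LinearMap.ker A.mulVecLin := by
    ext S
    simp only [Submodule.mem_iInf, LinearMap.mem_ker, Matrix.mulVecLin_apply, funext_iff]
    have : ∀ k, A.mulVec S k = fn x (s.orderEmbOfFin rfl k) S := by
      intro k
      rw [fn_apply]
      simp [hA, Matrix.mulVec, dotProduct, mul_comm]
    simp only [this, Pi.zero_apply]
    constructor
    · intro h k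
      exact h _ (Finset.orderEmbOfFin_mem s rfl k)
    · intro h i hi
      have : i ∈ Set.range (s.orderEmbOfFin rfl) := by
        rw [Finset.range_orderEmbOfFin]; exact hi
      obtain ⟨k, rfl⟩ := this
      exact h k
  have hr : A.rank = s.card := by
    have := LinearIndependent.rank_matrix (M := A) h
    simpa using this
  have := A.mulVecLin.finrank_range_add_finrank_ker
  rw [hker]
  unfold Matrix.rank at hr
  rw [hr] at this
  simp at this
  omega

lemma ae_gp (d N : ℕ) : ∀ᵐ x ∂(Measure.pi fun _ : Fin N => nu d), ∀ s : Finset (Fin N),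
    Module.finrank ℝ (⨅ i ∈ s, LinearMap.ker (fn x i) : Submodule ℝ (Fin d → ℝ)) = d - s.card := by
  have h1 : ∀ᵐ x ∂(Measure.pi fun _ : Fin N => nu d), ∀ s : Finset (Fin N), s.card ≤ d →
      LinearIndependent ℝ (fun k => x (s.orderEmbOfFin rfl k)) := by
    rw [ae_all_iff]
    intro s
    by_cases hs : s.card ≤ d
    · have := (measurePreserving_reindex (nu d) (s.orderEmbOfFin rfl)
        (s.orderEmbOfFin rfl).injective).quasiMeasurePreserving.ae
          (ae_linearIndependent d s.card hs)
      filter_upwards [this] with x hx _ using hx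
    · exact Filter.Eventually.of_forall fun x h => absurd h hs
  filter_upwards [h1] with x hx s
  rcases le_total s.card d with hs | hs
  · exact finrank_of_li x s (hx s hs)
  · obtain ⟨t, hts, htc⟩ := Finset.exists_subset_card_eq hs
    have h2 := finrank_of_li x t (hx t htc.le)
    rw [htc, Nat.sub_self] at h2
    rw [Nat.sub_eq_zero_of_le hs, ← Nat.le_zero, ← h2]
    exact Submodule.finrank_mono (biInf_mono fun i hi => hts hi)

end Wendel

namespace Wendel

lemma feas_iff {d N : ℕ} (x : Fin N → Fin d → ℝ) (ε : Fin N → Bool) :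
    Feas ⊤ (fn x) ε ↔ SeparableFromOrigin (fun i j => sg (ε i) * x i j) := by
  unfold Feas SeparableFromOrigin
  simp only [Submodule.mem_top, true_and, fn_apply, Finset.mul_sum]
  refine exists_congr fun S => forall_congr' fun i => ?_
  rw [Finset.sum_congr rfl fun j _ => mul_left_comm (sg (ε i)) (S j) (x i j)]

lemma mp_sign {d N : ℕ} (ε : Fin N → Bool) :
    MeasurePreserving (fun (x : Fin N → Fin d → ℝ) i j => sg (ε i) * x i j)
      (Measure.pi fun _ : Fin N => nu d) (Measure.pi fun _ : Fin N => nu d) := by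
  refine measurePreserving_pi (fun _ : Fin N => nu d) (fun _ : Fin N => nu d)
    (f := fun i y j => sg (ε i) * y j) fun i => ?_
  refine measurePreserving_pi (fun _ : Fin d => gaussianReal 0 1)
    (fun _ : Fin d => gaussianReal 0 1) (f := fun _ t => sg (ε i) * t) fun j => ?_
  refine ⟨by fun_prop, ?_⟩
  cases ε i
  · simpa [sg] using gaussianReal_map_neg (μ := 0) (v := 1)
  · simp [sg]

lemma isOpen_sep (d N : ℕ) : IsOpen {x : Fin N → Fin d → ℝ | SeparableFromOrigin x} := by
  have : {x : Fin N → Fin d → ℝ | SeparableFromOrigin x}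
      = ⋃ S : Fin d → ℝ, ⋂ i, {x : Fin N → Fin d → ℝ | 0 < ∑ j, S j * x i j} := by
    ext x; simp [SeparableFromOrigin]
  rw [this]
  refine isOpen_iUnion fun S => isOpen_iInter_of_finite fun i => ?_
  exact isOpen_lt (by fun_prop) (by fun_prop)

lemma wendel (d N : ℕ) :
    2 ^ N * (Measure.pi fun _ : Fin N => nu d) {x : Fin N → Fin d → ℝ | SeparableFromOrigin x}
      = (g N d : ENNReal) := by
  classical
  set μ := (Measure.pi fun _ : Fin N => nu d)
  set A := {x : Fin N → Fin d → ℝ | SeparableFromOrigin x} with hA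
  have hAm : MeasurableSet A := (isOpen_sep d N).measurableSet
  let T : (Fin N → Bool) → (Fin N → Fin d → ℝ) → (Fin N → Fin d → ℝ) :=
    fun ε x i j => sg (ε i) * x i j
  have hT : ∀ ε, MeasurePreserving (T ε) μ μ := fun ε => mp_sign ε
  have h1 : ∫⁻ x, ∑ ε, (T ε ⁻¹' A).indicator 1 x ∂μ = 2 ^ N * μ A := by
    rw [lintegral_finsetSum _ fun ε _ => measurable_one.indicator ((hT ε).measurable hAm)]
    have : ∀ ε ∈ Finset.univ, ∫⁻ x, (T ε ⁻¹' A).indicator 1 x ∂μ = μ A := by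
      intro ε _
      rw [lintegral_indicator_one ((hT ε).measurable hAm),
        (hT ε).measure_preimage hAm.nullMeasurableSet]
    rw [Finset.sum_congr rfl this]
    simp
  have h2 : ∫⁻ x, ∑ ε, (T ε ⁻¹' A).indicator 1 x ∂μ = ∫⁻ _, (g N d : ENNReal) ∂μ := by
    refine lintegral_congr_ae ?_
    filter_upwards [ae_gp d N] with x hx
    have hc := cnt_eq N ⊤ (fn x) (fun s => by
      rw [top_inf_eq, hx s]; simp)
    simp only [finrank_top, Module.finrank_fin_fun] at hc
    rw [← hc, cnt]
    push_cast
    refine Finset.sum_congr rfl fun ε _ => ?_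
    simp only [Set.indicator_apply, Set.mem_preimage, hA, Set.mem_ofPred_eq, feas_iff, T, Pi.one_apply]
  rw [← h1, h2]
  simp [μ]

end Wendel

/-- At the critical ratio `λ = 1/2` (that is, `N = 2d` standard Gaussian
samples in `ℝ^d`) the separability probability is exactly `1/2` for every `d ≥ 1`;
equivalently, `2^{−(2d−1)} Σ_{k=0}^{d−1} C(2d−1, k) = 1/2`. -/
theorem separability_probability_at_critical_ratio (d : ℕ) (hd : 1 ≤ d) :
    ((Measure.pi fun _ : Fin (2 * d) => (Measure.pi fun _ : Fin d => gaussianReal 0 1))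
        {x : Fin (2 * d) → Fin d → ℝ | SeparableFromOrigin x}).toReal = 1 / 2 ∧
    (2 ^ (2 * d - 1) : ℝ)⁻¹ * ∑ k ∈ Finset.range d, ((2 * d - 1).choose k : ℝ) = 1 / 2 := by
  obtain ⟨m, rfl⟩ : ∃ m, d = m + 1 := ⟨d - 1, by omega⟩
  have hs := Nat.sum_range_choose_halfway m
  have e1 : 2 * (m + 1) - 1 = 2 * m + 1 := by omega
  constructor
  · have h := congrArg ENNReal.toReal (Wendel.wendel (m + 1) (2 * (m + 1)))
    have hg : Wendel.g (2 * (m + 1)) (m + 1) = 2 * 4 ^ m := by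
      rw [show 2 * (m + 1) = (2 * m + 1) + 1 by ring, Wendel.g_eq, hs]
    rw [hg, ENNReal.toReal_mul] at h
    simp only [ENNReal.toReal_pow, ENNReal.toReal_ofNat, ENNReal.toReal_natCast] at h
    push_cast at h
    rw [pow_mul, pow_succ] at h
    norm_num at h
    have h4 : (4:ℝ) ^ m ≠ 0 := by positivity
    refine mul_left_cancel₀ (mul_ne_zero h4 (by norm_num : (4:ℝ) ≠ 0)) ?_
    refine h.trans ?_
    ring
  · rw [e1]
    have hs' : ∑ k ∈ Finset.range (m + 1), ((2 * m + 1).choose k : ℝ) = 4 ^ m := by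
      exact_mod_cast hs
    rw [hs', pow_succ, pow_mul]
    norm_num
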